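/- arXiv:1709.05276 — 2 statements merged into one kernel-verified Lean document; each statement's English description precedes it below -/
import Mathlib

section
/- A probability distribution p ∈ Δ7 belongs to the model M_{3,3} if and only if at least one of the six conditions C1–C6 holds for p. -/
open Real

/-- A `2 × 2 × 2` real tensor. -/
abbrev Tensor : Type := Fin 2 → Fin 2 → Fin 2 → ℝ

/-- `p` is a probability distribution: nonnegative entries summing to 1 (membership in Δ₇). -/
def isDist (p : Tensor) : Prop :=
  (∀ i j k, 0 ≤ p i j k) ∧ (∑ i, ∑ j, ∑ k, p i j k) = 1

/-- `q` is a nonnegative rank-one `2 × 2 × 2` tensor. -/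
def rankOne (q : Tensor) : Prop :=
  ∃ a b c : Fin 2 → ℝ, (∀ i, 0 ≤ a i) ∧ (∀ i, 0 ≤ b i) ∧ (∀ i, 0 ≤ c i) ∧
    ∀ i j k, q i j k = a i * b j * c k

/-- Membership in the model `RBM_{3,2}`. -/
def inRBM32 (p : Tensor) : Prop :=
  isDist p ∧ ∃ q r s t : Tensor, rankOne q ∧ rankOne r ∧ rankOne s ∧ rankOne t ∧
    ∀ i j k, p i j k = (q i j k + r i j k) * (s i j k + t i j k)

/-- Membership in the mixture model `M_{3,3}`. -/
def inM33 (p : Tensor) : Prop :=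
  isDist p ∧ ∃ q r s : Tensor, rankOne q ∧ rankOne r ∧ rankOne s ∧
    ∀ i j k, p i j k = q i j k + r i j k + s i j k

def C1 (p : Tensor) : Prop :=
  p 0 0 0 * p 0 1 1 ≥ p 0 0 1 * p 0 1 0 ∧ p 1 0 0 * p 1 1 1 ≥ p 1 0 1 * p 1 1 0

def C2 (p : Tensor) : Prop :=
  p 0 0 0 * p 0 1 1 ≤ p 0 0 1 * p 0 1 0 ∧ p 1 0 0 * p 1 1 1 ≤ p 1 0 1 * p 1 1 0

def C3 (p : Tensor) : Prop :=
  p 0 0 0 * p 1 0 1 ≥ p 0 0 1 * p 1 0 0 ∧ p 0 1 0 * p 1 1 1 ≥ p 0 1 1 * p 1 1 0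

def C4 (p : Tensor) : Prop :=
  p 0 0 0 * p 1 0 1 ≤ p 0 0 1 * p 1 0 0 ∧ p 0 1 0 * p 1 1 1 ≤ p 0 1 1 * p 1 1 0

def C5 (p : Tensor) : Prop :=
  p 0 0 0 * p 1 1 0 ≥ p 1 0 0 * p 0 1 0 ∧ p 0 0 1 * p 1 1 1 ≥ p 1 0 1 * p 0 1 1

def C6 (p : Tensor) : Prop :=
  p 0 0 0 * p 1 1 0 ≤ p 1 0 0 * p 0 1 0 ∧ p 0 0 1 * p 1 1 1 ≤ p 1 0 1 * p 0 1 1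

/-- The pair covariance of `y` and `z` under the weights `w r * u r`; it equals twice the determinant
of a slice of a mixture of product distributions. -/
def pairCov (w u y z : Fin 3 → ℝ) : ℝ :=
  ∑ r, ∑ s, w r * w s * (u r * u s) * ((y r - y s) * (z r - z s))

lemma pairCov_eq (w u y z : Fin 3 → ℝ) {r s t : Fin 3} (hrs : r ≠ s) (hrt : r ≠ t) (hst : s ≠ t) :
    pairCov w u y z = 2 * (w r * w s * (u r * u s) * ((y r - y s) * (z r - z s)) +
      w r * w t * (u r * u t) * ((y r - y t) * (z r - z t)) +
      w s * w t * (u s * u t) * ((y s - y t) * (z s - z t))) := by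
  simp only [pairCov, Fin.sum_univ_three]
  fin_cases r <;> fin_cases s <;> first | exact absurd rfl hrs | skip
  all_goals fin_cases t <;> first | exact absurd rfl hrt | exact absurd rfl hst | skip
  all_goals simp only [Fin.zero_eta, Fin.mk_one, Fin.reduceFinMk]; ring

lemma pairCov_flip_left (w u y z : Fin 3 → ℝ) :
    pairCov w u (fun r => 1 - y r) z = -pairCov w u y z := by
  simp only [pairCov, Fin.sum_univ_three]; ring

lemma pairCov_flip_right (w u y z : Fin 3 → ℝ) :
    pairCov w u y (fun r => 1 - z r) = -pairCov w u y z := by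
  simp only [pairCov, Fin.sum_univ_three]; ring

lemma pairCov_nonneg {w u y z : Fin 3 → ℝ} (hw : ∀ r, 0 ≤ w r) (hu : ∀ r, 0 ≤ u r)
    (h : ∀ r s, 0 ≤ (y r - y s) * (z r - z s)) : 0 ≤ pairCov w u y z :=
  Finset.sum_nonneg fun r _ => Finset.sum_nonneg fun s _ =>
    mul_nonneg (mul_nonneg (mul_nonneg (hw r) (hw s)) (mul_nonneg (hu r) (hu s))) (h r s)

lemma pairCov_nonpos {w u y z : Fin 3 → ℝ} (hw : ∀ r, 0 ≤ w r) (hu : ∀ r, 0 ≤ u r)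
    (h : ∀ r s, (y r - y s) * (z r - z s) ≤ 0) : pairCov w u y z ≤ 0 :=
  Finset.sum_nonpos fun r _ => Finset.sum_nonpos fun s _ =>
    mul_nonpos_of_nonneg_of_nonpos
      (mul_nonneg (mul_nonneg (hw r) (hw s)) (mul_nonneg (hu r) (hu s))) (h r s)

/-- The value of `x` at `r` lies between its two other values. -/
def IsMiddle (x : Fin 3 → ℝ) (r : Fin 3) : Prop :=
  ∀ s t, r ≠ s → r ≠ t → s ≠ t → (x s ≤ x r ∧ x r ≤ x t) ∨ (x t ≤ x r ∧ x r ≤ x s)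

lemma isMiddle_of {x : Fin 3 → ℝ} {r s t : Fin 3} (hrs : r ≠ s) (hrt : r ≠ t) (hst : s ≠ t)
    (h1 : x s ≤ x r) (h2 : x r ≤ x t) : IsMiddle x r := by
  intro s' t' h h' h''
  have : (s' = s ∧ t' = t) ∨ (s' = t ∧ t' = s) := by omega
  rcases this with ⟨rfl, rfl⟩ | ⟨rfl, rfl⟩
  · exact Or.inl ⟨h1, h2⟩
  · exact Or.inr ⟨h1, h2⟩

lemma exists_isMiddle (x : Fin 3 → ℝ) : ∃ r, IsMiddle x r := by
  rcases le_total (x 0) (x 1) with h01 | h01 <;> rcases le_total (x 0) (x 2) with h02 | h02 <;>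
    rcases le_total (x 1) (x 2) with h12 | h12
  · exact ⟨1, isMiddle_of (by decide) (by decide) (by decide) h01 h12⟩
  · exact ⟨2, isMiddle_of (by decide) (by decide) (by decide) h02 h12⟩
  · exact ⟨0, isMiddle_of (by decide) (by decide) (by decide) h02 h01⟩
  · exact ⟨0, isMiddle_of (by decide) (by decide) (by decide) h02 h01⟩
  · exact ⟨0, isMiddle_of (by decide) (by decide) (by decide) h01 h02⟩
  · exact ⟨0, isMiddle_of (by decide) (by decide) (by decide) h01 h02⟩
  · exact ⟨2, isMiddle_of (by decide) (by decide) (by decide) h12 h02⟩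
  · exact ⟨1, isMiddle_of (by decide) (by decide) (by decide) h12 h01⟩

lemma IsMiddle.mul_sub_nonneg_or_nonpos {y z : Fin 3 → ℝ} {r : Fin 3} (hy : IsMiddle y r)
    (hz : IsMiddle z r) : (∀ a b, 0 ≤ (y a - y b) * (z a - z b)) ∨
      ∀ a b, (y a - y b) * (z a - z b) ≤ 0 := by
  obtain ⟨s, t, hrs, hrt, hst⟩ : ∃ s t : Fin 3, r ≠ s ∧ r ≠ t ∧ s ≠ t := by
    clear hy hz; revert r; decide
  have hc : ∀ a : Fin 3, a = r ∨ a = s ∨ a = t := by intro a; omega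
  rcases hy s t hrs hrt hst with ⟨h1, h2⟩ | ⟨h1, h2⟩ <;>
    rcases hz s t hrs hrt hst with ⟨h3, h4⟩ | ⟨h3, h4⟩
  · left; intro a b
    rcases hc a with rfl | rfl | rfl <;> rcases hc b with rfl | rfl | rfl <;>
      first
      | exact mul_nonneg (by linarith) (by linarith)
      | exact mul_nonneg_of_nonpos_of_nonpos (by linarith) (by linarith)
  · right; intro a b
    rcases hc a with rfl | rfl | rfl <;> rcases hc b with rfl | rfl | rfl <;>
      first
      | exact mul_nonpos_of_nonneg_of_nonpos (by linarith) (by linarith)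
      | exact mul_nonpos_of_nonpos_of_nonneg (by linarith) (by linarith)
  · right; intro a b
    rcases hc a with rfl | rfl | rfl <;> rcases hc b with rfl | rfl | rfl <;>
      first
      | exact mul_nonpos_of_nonneg_of_nonpos (by linarith) (by linarith)
      | exact mul_nonpos_of_nonpos_of_nonneg (by linarith) (by linarith)
  · left; intro a b
    rcases hc a with rfl | rfl | rfl <;> rcases hc b with rfl | rfl | rfl <;>
      first
      | exact mul_nonneg (by linarith) (by linarith)
      | exact mul_nonneg_of_nonpos_of_nonpos (by linarith) (by linarith)

/-- The two slices of the mixture along the first axis have determinants of opposite strict sign. -/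
def SlicesConflict (w x y z : Fin 3 → ℝ) : Prop :=
  pairCov w (fun r => 1 - x r) y z * pairCov w x y z < 0

lemma SlicesConflict.flip_first {w x y z : Fin 3 → ℝ} (h : SlicesConflict w x y z) :
    SlicesConflict w (fun r => 1 - x r) y z := by
  simp only [SlicesConflict, sub_sub_cancel] at h ⊢
  linarith

lemma SlicesConflict.flip_second {w x y z : Fin 3 → ℝ} (h : SlicesConflict w x y z) :
    SlicesConflict w x (fun r => 1 - y r) z := by
  simpa only [SlicesConflict, pairCov_flip_left, neg_mul_neg] using h

lemma SlicesConflict.flip_third {w x y z : Fin 3 → ℝ} (h : SlicesConflict w x y z) :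
    SlicesConflict w x y (fun r => 1 - z r) := by
  simpa only [SlicesConflict, pairCov_flip_right, neg_mul_neg] using h

lemma SlicesConflict.pos_or_pos {w x y z : Fin 3 → ℝ} (h : SlicesConflict w x y z) :
    0 < pairCov w (fun r => 1 - x r) y z ∨ 0 < pairCov w x y z := by
  rcases mul_neg_iff.1 h with h | h
  · exact Or.inl h.1
  · exact Or.inr h.2

lemma SlicesConflict.middle_ne {w x y z : Fin 3 → ℝ} (h : SlicesConflict w x y z)
    (hw : ∀ r, 0 ≤ w r) (hx : ∀ r, x r ∈ Set.Icc 0 1) {r s : Fin 3} (hy : IsMiddle y r)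
    (hz : IsMiddle z s) : r ≠ s := by
  rintro rfl
  have h0 : ∀ r, 0 ≤ x r := fun r => (hx r).1
  have h1 : ∀ r, 0 ≤ 1 - x r := fun r => sub_nonneg.2 (hx r).2
  rcases hy.mul_sub_nonneg_or_nonpos hz with hs | hs
  · exact absurd h (not_lt.2 (mul_nonneg (pairCov_nonneg hw h1 hs) (pairCov_nonneg hw h0 hs)))
  · exact absurd h (not_lt.2 (mul_nonneg_of_nonpos_of_nonpos (pairCov_nonpos hw h1 hs)
      (pairCov_nonpos hw h0 hs)))

lemma pos_of_mul_pos_of_nonneg {a b : ℝ} (ha : 0 ≤ a) (hb : 0 ≤ b) (h : 0 < a * b) :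
    0 < a ∧ 0 < b :=
  ⟨pos_of_mul_pos_left h hb, pos_of_mul_pos_right h ha⟩

/-- If one slice determinant is dominated by its only nonnegative term, that term strictly beats
each of the two others. -/
lemma dominant_pair {w₁ w₂ w₃ u₁ u₂ u₃ A B₁ B₂ C₁ C₂ P : ℝ} (hw₁ : 0 ≤ w₁) (hw₂ : 0 ≤ w₂)
    (hw₃ : 0 ≤ w₃) (hu₁ : 0 ≤ u₁) (hu₂ : 0 ≤ u₂) (hu₃ : 0 ≤ u₃) (hA : 0 ≤ A) (hP : 0 ≤ P)
    (hB : 0 ≤ B₁ * B₂) (hC : 0 ≤ C₁ * C₂)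
    (h : 0 < w₁ * w₂ * (u₁ * u₂) * (A * P) - w₁ * w₃ * (u₁ * u₃) * (B₁ * B₂) -
      w₂ * w₃ * (u₂ * u₃) * (C₁ * C₂)) :
    0 < w₁ ∧ 0 < w₂ ∧ 0 < u₁ ∧ 0 < u₂ ∧ 0 < A ∧ 0 < P ∧
      w₃ * u₃ * (C₁ * C₂) < w₁ * u₁ * (A * P) := by
  have h1 : 0 ≤ w₁ * w₃ * (u₁ * u₃) * (B₁ * B₂) := by positivity
  have h2 : 0 ≤ w₂ * w₃ * (u₂ * u₃) * (C₁ * C₂) := by positivity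
  have h3 : 0 < w₁ * w₂ * (u₁ * u₂) * (A * P) := by linarith
  obtain ⟨h4, h5⟩ := pos_of_mul_pos_of_nonneg (by positivity) (by positivity) h3
  obtain ⟨h6, h7⟩ := pos_of_mul_pos_of_nonneg (by positivity) (by positivity) h4
  obtain ⟨h8, h9⟩ := pos_of_mul_pos_of_nonneg hw₁ hw₂ h6
  obtain ⟨h10, h11⟩ := pos_of_mul_pos_of_nonneg hu₁ hu₂ h7
  obtain ⟨h12, h13⟩ := pos_of_mul_pos_of_nonneg hA hP h5
  refine ⟨h8, h9, h10, h11, h12, h13, ?_⟩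
  have : 0 < (w₂ * u₂) * (w₁ * u₁ * (A * P) - w₃ * u₃ * (C₁ * C₂)) := by nlinarith
  linarith [pos_of_mul_pos_right this (by positivity)]

lemma cyclic_order_contradiction {w x y z : Fin 3 → ℝ} {r s t : Fin 3} (hrs : r ≠ s) (hrt : r ≠ t)
    (hst : s ≠ t) (hw : ∀ r, 0 ≤ w r) (hx : ∀ r, x r ∈ Set.Icc 0 1) (hz : ∀ r, z r ∈ Set.Icc 0 1)
    (hx₁ : x s ≤ x r) (hx₂ : x r ≤ x t) (hy₁ : y t ≤ y s) (hy₂ : y s ≤ y r)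
    (hz₁ : z r ≤ z t) (hz₂ : z t ≤ z s)
    (hD : 0 < pairCov w (fun r => 1 - x r) y z)
    (hE : 0 < pairCov w (fun r => 1 - z r) x y ∨ 0 < pairCov w z x y) : False := by
  have hx0 : ∀ r, 0 ≤ x r := fun r => (hx r).1
  have hx1 : ∀ r, 0 ≤ 1 - x r := fun r => sub_nonneg.2 (hx r).2
  have hz0 : ∀ r, 0 ≤ z r := fun r => (hz r).1
  have hz1 : ∀ r, 0 ≤ 1 - z r := fun r => sub_nonneg.2 (hz r).2
  rw [pairCov_eq _ _ _ _ hrs hrt hst] at hD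
  simp only [pairCov_eq _ _ _ _ hrs hrt hst] at hE
  obtain ⟨-, -, hut, -, hYst, hZst, hd⟩ := dominant_pair (hw t) (hw s) (hw r) (hx1 t) (hx1 s)
    (hx1 r) (sub_nonneg.2 hy₁) (sub_nonneg.2 hz₂)
    (mul_nonneg (sub_nonneg.2 (hy₁.trans hy₂)) (sub_nonneg.2 hz₁))
    (mul_nonneg (sub_nonneg.2 hy₂) (sub_nonneg.2 (hz₁.trans hz₂))) (by linarith)
  have hzt : 0 < 1 - z t := by linarith [hz1 s]
  have hYrs := sub_nonneg.2 hy₂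
  have lower : w r * (1 - x r) * (1 - z r) * (y r - y s) <
      w t * (1 - x t) * (1 - z t) * (y s - y t) := by
    have h1 := mul_lt_mul_of_pos_right hd hzt
    have h2 : (1 - z r) * (z s - z t) ≤ (1 - z t) * (z s - z r) := by
      nlinarith [mul_nonneg (hz1 s) (sub_nonneg.2 hz₁)]
    have h3 := mul_le_mul_of_nonneg_left h2
      (mul_nonneg (mul_nonneg (hw r) (hx1 r)) hYrs)
    refine lt_of_mul_lt_mul_right (a := z s - z t) ?_ hZst.le
    linarith
  have hxst : (1 - x t) * (x r - x s) ≤ (1 - x r) * (x t - x s) := by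
    nlinarith [mul_nonneg (hx1 s) (sub_nonneg.2 hx₂)]
  have hxr : 0 < 1 - x r := by linarith
  have upper : w t * (1 - x t) * (1 - z t) * (y s - y t) <
      w r * (1 - x r) * (1 - z r) * (y r - y s) := by
    rcases hE with hE | hE
    · obtain ⟨-, -, -, -, hX, -, he⟩ := dominant_pair (hw r) (hw s) (hw t) (hz1 r) (hz1 s) (hz1 t)
        (sub_nonneg.2 hx₁) hYrs
        (mul_nonneg (sub_nonneg.2 hx₂) (sub_nonneg.2 (hy₁.trans hy₂)))
        (mul_nonneg (sub_nonneg.2 (hx₁.trans hx₂)) hYst.le) (by linarith)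
      have h1 := mul_lt_mul_of_pos_right he hxr
      have h3 := mul_le_mul_of_nonneg_left hxst
        (mul_nonneg (mul_nonneg (hw t) (hz1 t)) hYst.le)
      refine lt_of_mul_lt_mul_right (a := x r - x s) ?_ hX.le
      linarith
    · obtain ⟨-, -, hzr, -, hX, hY, he⟩ := dominant_pair (hw r) (hw s) (hw t) (hz0 r) (hz0 s)
        (hz0 t) (sub_nonneg.2 hx₁) hYrs
        (mul_nonneg (sub_nonneg.2 hx₂) (sub_nonneg.2 (hy₁.trans hy₂)))
        (mul_nonneg (sub_nonneg.2 (hx₁.trans hx₂)) hYst.le) (by linarith)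
      have h1 := mul_lt_mul_of_pos_right (mul_lt_mul_of_pos_right he hxr) hzt
      have h3 := mul_le_mul_of_nonneg_left hxst
        (mul_nonneg (mul_nonneg (mul_nonneg (hw t) (hz0 t)) hYst.le) hzt.le)
      have h4 : z r * (1 - z t) ≤ z t * (1 - z r) := by linarith
      have h5 := mul_le_mul_of_nonneg_left h4
        (mul_nonneg (mul_nonneg (mul_nonneg (hw r) hxr.le) hX.le) hY.le)
      have hzt0 : 0 < z t := hzr.trans_le hz₁
      refine lt_of_mul_lt_mul_right (a := (x r - x s) * z t) ?_ (by positivity)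
      linarith
  exact lt_asymm lower upper

lemma pairCov_comm (w u y z : Fin 3 → ℝ) : pairCov w u y z = pairCov w u z y := by
  simp only [pairCov, mul_comm (y _ - y _)]

lemma not_conflict_of_cyclic_order {w x y z : Fin 3 → ℝ} {r s t : Fin 3} (hrs : r ≠ s) (hrt : r ≠ t)
    (hst : s ≠ t) (hw : ∀ r, 0 ≤ w r) (hx : ∀ r, x r ∈ Set.Icc 0 1) (hy : ∀ r, y r ∈ Set.Icc 0 1)
    (hz : ∀ r, z r ∈ Set.Icc 0 1)
    (hx₁ : x s ≤ x r) (hx₂ : x r ≤ x t) (hy₁ : y t ≤ y s) (hy₂ : y s ≤ y r)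
    (hz₁ : z r ≤ z t) (hz₂ : z t ≤ z s) (h1 : SlicesConflict w x y z)
    (h2 : SlicesConflict w y x z) (h3 : SlicesConflict w z x y) : False := by
  have flip : ∀ {v : Fin 3 → ℝ}, (∀ r, v r ∈ Set.Icc (0 : ℝ) 1) →
      ∀ r, 1 - v r ∈ Set.Icc (0 : ℝ) 1 :=
    fun hv r => ⟨sub_nonneg.2 (hv r).2, sub_le_self _ (hv r).1⟩
  rcases h1.pos_or_pos with h | h
  · exact cyclic_order_contradiction hrs hrt hst hw hx hz hx₁ hx₂ hy₁ hy₂ hz₁ hz₂ h h3.pos_or_pos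
  · refine cyclic_order_contradiction (x := fun r => 1 - x r) (y := fun r => 1 - z r)
      (z := fun r => 1 - y r) hrt hrs hst.symm hw (flip hx) (flip hy) (by linarith) (by linarith)
      (by linarith) (by linarith) (by linarith) (by linarith) ?_ ?_
    · simpa only [sub_sub_cancel, pairCov_flip_left, pairCov_flip_right, neg_neg,
        pairCov_comm w x z y] using h
    · exact h2.flip_first.flip_second.flip_third.pos_or_pos

lemma not_conflict {w x y z : Fin 3 → ℝ} (hw : ∀ r, 0 ≤ w r) (hx : ∀ r, x r ∈ Set.Icc 0 1)
    (hy : ∀ r, y r ∈ Set.Icc 0 1) (hz : ∀ r, z r ∈ Set.Icc 0 1) (h1 : SlicesConflict w x y z)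
    (h2 : SlicesConflict w y x z) (h3 : SlicesConflict w z x y) : False := by
  obtain ⟨r, hr⟩ := exists_isMiddle x
  obtain ⟨s, hs⟩ := exists_isMiddle y
  obtain ⟨t, ht⟩ := exists_isMiddle z
  have hst := h1.middle_ne hw hx hs ht
  have hrt := h2.middle_ne hw hy hr ht
  have hrs := h3.middle_ne hw hz hr hs
  have flip : ∀ {v : Fin 3 → ℝ}, (∀ r, v r ∈ Set.Icc (0 : ℝ) 1) →
      ∀ r, 1 - v r ∈ Set.Icc (0 : ℝ) 1 :=
    fun hv r => ⟨sub_nonneg.2 (hv r).2, sub_le_self _ (hv r).1⟩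
  wlog hxo : x s ≤ x r ∧ x r ≤ x t generalizing x
  · have hxo' := (hr s t hrs hrt hst).resolve_left hxo
    refine this (x := fun r => 1 - x r) (flip hx) h1.flip_first h2.flip_second h3.flip_second ?_
      ⟨by linarith, by linarith⟩
    exact isMiddle_of hrs hrt hst (by linarith) (by linarith)
  wlog hyo : y t ≤ y s ∧ y s ≤ y r generalizing y
  · have hyo' := (hs t r hst hrs.symm hrt.symm).resolve_left hyo
    refine this (y := fun r => 1 - y r) (flip hy) ?_ h1.flip_second h2.flip_first h3.flip_third
      ⟨by linarith, by linarith⟩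
    exact isMiddle_of hst hrs.symm hrt.symm (by linarith) (by linarith)
  wlog hzo : z r ≤ z t ∧ z t ≤ z s generalizing z
  · have hzo' := (ht r s hrt.symm hst.symm hrs).resolve_left hzo
    refine this (z := fun r => 1 - z r) (flip hz) ?_ h1.flip_third h2.flip_third h3.flip_first
      ⟨by linarith, by linarith⟩
    exact isMiddle_of hrt.symm hst.symm hrs (by linarith) (by linarith)
  exact not_conflict_of_cyclic_order hrs hrt hst hw hx hy hz hxo.1 hxo.2 hyo.1 hyo.2 hzo.1 hzo.2
    h1 h2 h3

lemma exists_scaled_bernoulli {a : Fin 2 → ℝ} (ha : ∀ i, 0 ≤ a i) :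
    ∃ w x : ℝ, 0 ≤ w ∧ x ∈ Set.Icc (0 : ℝ) 1 ∧ a 0 = w * (1 - x) ∧ a 1 = w * x := by
  have h0 := ha 0
  have h1 := ha 1
  rcases (add_nonneg h0 h1).eq_or_lt with h | h
  · exact ⟨0, 0, le_rfl, ⟨le_rfl, zero_le_one⟩, by linarith, by linarith⟩
  · refine ⟨a 0 + a 1, a 1 / (a 0 + a 1), h.le, ⟨by positivity, ?_⟩, ?_, ?_⟩
    · rw [div_le_one h]; linarith
    · field_simp; ring
    · field_simp

lemma rankOne.exists_scaled_bernoulli {q : Tensor} (hq : rankOne q) :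
    ∃ w x y z : ℝ, 0 ≤ w ∧ x ∈ Set.Icc (0 : ℝ) 1 ∧ y ∈ Set.Icc (0 : ℝ) 1 ∧ z ∈ Set.Icc (0 : ℝ) 1 ∧
      ∀ i j k, q i j k = w * ![1 - x, x] i * ![1 - y, y] j * ![1 - z, z] k := by
  obtain ⟨a, b, c, ha, hb, hc, h⟩ := hq
  obtain ⟨u, x, hu, hx, ha0, ha1⟩ := _root_.exists_scaled_bernoulli ha
  obtain ⟨v, y, hv, hy, hb0, hb1⟩ := _root_.exists_scaled_bernoulli hb
  obtain ⟨w, z, hw, hz, hc0, hc1⟩ := _root_.exists_scaled_bernoulli hc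
  have pointwise : ∀ {f : Fin 2 → ℝ} {m n : ℝ}, f 0 = m * (1 - n) → f 1 = m * n →
      ∀ i, f i = m * ![1 - n, n] i := by
    intro f m n h0 h1 i
    fin_cases i
    · exact h0
    · exact h1
  refine ⟨u * v * w, x, y, z, by positivity, hx, hy, hz, fun i j k => ?_⟩
  rw [h, pointwise ha0 ha1, pointwise hb0 hb1, pointwise hc0 hc1]
  ring

/-- A nonnegative `2 × 2` matrix with nonnegative determinant is a nonnegative rank-one matrix plus a
nonnegative multiple of the first matrix unit. -/
lemma exists_rankOne_add_corner {a b c d : ℝ} (ha : 0 ≤ a) (hb : 0 ≤ b) (hc : 0 ≤ c) (hd : 0 ≤ d)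
    (h : b * c ≤ a * d) : ∃ t : ℝ, ∃ u v : Fin 2 → ℝ, 0 ≤ t ∧ (∀ i, 0 ≤ u i) ∧ (∀ i, 0 ≤ v i) ∧
      a = t + u 0 * v 0 ∧ b = u 0 * v 1 ∧ c = u 1 * v 0 ∧ d = u 1 * v 1 := by
  rcases hd.eq_or_lt with rfl | hd
  · rcases mul_eq_zero.1 (le_antisymm (by linarith) (mul_nonneg hb hc)) with rfl | rfl
    · exact ⟨0, ![a, c], ![1, 0], le_rfl, by simp [ha, hc], by simp, by simp, by simp, by simp,
        by simp⟩
    · exact ⟨0, ![1, 0], ![a, b], le_rfl, by simp, by simp [ha, hb], by simp, by simp, by simp,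
        by simp⟩
  · refine ⟨a - b * c / d, ![b / d, 1], ![c, d], ?_, ?_, ?_, ?_, ?_, ?_, ?_⟩
    · rw [sub_nonneg, div_le_iff₀ hd]; exact h
    · simp [div_nonneg hb hd.le]
    · simp [hc, hd.le]
    · simp; ring
    · simp; field_simp
    · simp
    · simp

/-- The sum of three nonnegative rank-one tensors. -/
def IsThreeMixture (p : Tensor) : Prop :=
  ∃ q r s : Tensor, rankOne q ∧ rankOne r ∧ rankOne s ∧ ∀ i j k, p i j k = q i j k + r i j k + s i j k

lemma isThreeMixture_of_C1 {p : Tensor} (hp : ∀ i j k, 0 ≤ p i j k) (h : C1 p) :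
    IsThreeMixture p := by
  obtain ⟨t, u, v, ht, hu, hv, h1, h2, h3, h4⟩ := exists_rankOne_add_corner (hp 0 0 0) (hp 0 0 1)
    (hp 0 1 0) (hp 0 1 1) h.1
  obtain ⟨t', u', v', ht', hu', hv', h1', h2', h3', h4'⟩ := exists_rankOne_add_corner (hp 1 0 0)
    (hp 1 0 1) (hp 1 1 0) (hp 1 1 1) h.2
  refine ⟨_, _, _, ⟨![t, t'], ![1, 0], ![1, 0], by simp [ht, ht'], by simp, by simp,
    fun i j k => rfl⟩, ⟨![1, 0], u, v, by simp, hu, hv, fun i j k => rfl⟩,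
    ⟨![0, 1], u', v', by simp, hu', hv', fun i j k => rfl⟩, fun i j k => ?_⟩
  fin_cases i <;> fin_cases j <;> fin_cases k <;> simp [*]

lemma rankOne.rev_third {q : Tensor} (h : rankOne q) : rankOne fun i j k => q i j k.rev := by
  obtain ⟨a, b, c, ha, hb, hc, h⟩ := h
  exact ⟨a, b, fun k => c k.rev, ha, hb, fun k => hc k.rev, fun i j k => h i j k.rev⟩

lemma rankOne.swap_first {q : Tensor} (h : rankOne q) : rankOne fun i j k => q j i k := by
  obtain ⟨a, b, c, ha, hb, hc, h⟩ := h
  exact ⟨b, a, c, hb, ha, hc, fun i j k => by simp only [h]; ring⟩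

lemma rankOne.swap_outer {q : Tensor} (h : rankOne q) : rankOne fun i j k => q k j i := by
  obtain ⟨a, b, c, ha, hb, hc, h⟩ := h
  exact ⟨c, b, a, hc, hb, ha, fun i j k => by simp only [h]; ring⟩

lemma IsThreeMixture.of_rev_third {p : Tensor} (h : IsThreeMixture fun i j k => p i j k.rev) :
    IsThreeMixture p := by
  obtain ⟨q, r, s, hq, hr, hs, h⟩ := h
  exact ⟨_, _, _, hq.rev_third, hr.rev_third, hs.rev_third,
    fun i j k => by simp only [← h, Fin.rev_rev]⟩

lemma IsThreeMixture.of_swap_first {p : Tensor} (h : IsThreeMixture fun i j k => p j i k) :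
    IsThreeMixture p := by
  obtain ⟨q, r, s, hq, hr, hs, h⟩ := h
  exact ⟨_, _, _, hq.swap_first, hr.swap_first, hs.swap_first, fun i j k => h j i k⟩

lemma IsThreeMixture.of_swap_outer {p : Tensor} (h : IsThreeMixture fun i j k => p k j i) :
    IsThreeMixture p := by
  obtain ⟨q, r, s, hq, hr, hs, h⟩ := h
  exact ⟨_, _, _, hq.swap_outer, hr.swap_outer, hs.swap_outer, fun i j k => h k j i⟩

lemma isThreeMixture_of_C2 {p : Tensor} (hp : ∀ i j k, 0 ≤ p i j k) (h : C2 p) :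
    IsThreeMixture p :=
  (isThreeMixture_of_C1 (p := fun i j k => p i j k.rev) (fun i j k => hp i j k.rev)
    ⟨h.1, h.2⟩).of_rev_third

lemma isThreeMixture_of_conditions {p : Tensor} (hp : ∀ i j k, 0 ≤ p i j k)
    (h : C1 p ∨ C2 p ∨ C3 p ∨ C4 p ∨ C5 p ∨ C6 p) : IsThreeMixture p := by
  have hp₁ : ∀ i j k, 0 ≤ p j i k := fun i j k => hp j i k
  have hp₂ : ∀ i j k, 0 ≤ p k j i := fun i j k => hp k j i
  rcases h with h | h | h | h | h | h
  · exact isThreeMixture_of_C1 hp h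
  · exact isThreeMixture_of_C2 hp h
  · exact (isThreeMixture_of_C1 (p := fun i j k => p j i k) hp₁ h).of_swap_first
  · exact (isThreeMixture_of_C2 (p := fun i j k => p j i k) hp₁ h).of_swap_first
  · refine (isThreeMixture_of_C1 (p := fun i j k => p k j i) hp₂ ?_).of_swap_outer
    exact h
  · refine (isThreeMixture_of_C2 (p := fun i j k => p k j i) hp₂ ?_).of_swap_outer
    exact h

lemma mul_neg_of_not_and {a b c d : ℝ} (h1 : ¬(a ≥ b ∧ c ≥ d)) (h2 : ¬(a ≤ b ∧ c ≤ d)) :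
    2 * (a - b) * (2 * (c - d)) < 0 := by
  rcases lt_trichotomy a b with h | h | h
  · have : d < c := by by_contra! hc; exact h2 ⟨h.le, hc⟩
    exact mul_neg_of_neg_of_pos (by linarith) (by linarith)
  · rcases le_total c d with hc | hc
    · exact absurd ⟨h.le, hc⟩ h2
    · exact absurd ⟨h.ge, hc⟩ h1
  · have : c < d := by by_contra! hc; exact h1 ⟨h.le, hc⟩
    exact mul_neg_of_pos_of_neg (by linarith) (by linarith)

lemma IsThreeMixture.conditions {p : Tensor} (h : IsThreeMixture p) :
    C1 p ∨ C2 p ∨ C3 p ∨ C4 p ∨ C5 p ∨ C6 p := by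
  obtain ⟨q, r, s, hq, hr, hs, h⟩ := h
  obtain ⟨w₀, x₀, y₀, z₀, hw₀, hx₀, hy₀, hz₀, hq⟩ := hq.exists_scaled_bernoulli
  obtain ⟨w₁, x₁, y₁, z₁, hw₁, hx₁, hy₁, hz₁, hr⟩ := hr.exists_scaled_bernoulli
  obtain ⟨w₂, x₂, y₂, z₂, hw₂, hx₂, hy₂, hz₂, hs⟩ := hs.exists_scaled_bernoulli
  by_contra! hn
  obtain ⟨n1, n2, n3, n4, n5, n6⟩ := hn
  have c1 := mul_neg_of_not_and n1 n2
  have c2 := mul_neg_of_not_and n3 n4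
  have c3 := mul_neg_of_not_and n5 n6
  have forall_three : ∀ {P : ℝ → Prop} {a b c : ℝ}, P a → P b → P c → ∀ i, P (![a, b, c] i) := by
    intro P a b c ha hb hc i
    fin_cases i
    exacts [ha, hb, hc]
  refine not_conflict (w := ![w₀, w₁, w₂]) (x := ![x₀, x₁, x₂]) (y := ![y₀, y₁, y₂])
    (z := ![z₀, z₁, z₂]) (forall_three hw₀ hw₁ hw₂)
    (forall_three (P := (· ∈ Set.Icc 0 1)) hx₀ hx₁ hx₂)
    (forall_three (P := (· ∈ Set.Icc 0 1)) hy₀ hy₁ hy₂)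
    (forall_three (P := (· ∈ Set.Icc 0 1)) hz₀ hz₁ hz₂) ?_ ?_ ?_
  · refine lt_of_eq_of_lt (congrArg₂ (· * ·) ?_ ?_) c1 <;>
    · simp only [pairCov, Fin.sum_univ_three, h, hq, hr, hs, Matrix.cons_val]
      ring
  · refine lt_of_eq_of_lt (congrArg₂ (· * ·) ?_ ?_) c2 <;>
    · simp only [pairCov, Fin.sum_univ_three, h, hq, hr, hs, Matrix.cons_val]
      ring
  · refine lt_of_eq_of_lt (congrArg₂ (· * ·) ?_ ?_) c3 <;>
    · simp only [pairCov, Fin.sum_univ_three, h, hq, hr, hs, Matrix.cons_val]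
      ring

theorem stmt4 (p : Tensor) (hp : isDist p) :
    inM33 p ↔ (C1 p ∨ C2 p ∨ C3 p ∨ C4 p ∨ C5 p ∨ C6 p) :=
  ⟨fun h => IsThreeMixture.conditions h.2,
    fun h => ⟨hp, isThreeMixture_of_conditions hp.1 h⟩⟩
end

section
/- For all positive integers n and k, the set M_{n,k} is a closed subset of the space ℝ^{2^n} of real-valued functions on {0,1}^n. -/
/-- `q` is a nonnegative rank-one tensor on `{0,1}ⁿ`. -/
def rankOneN (n : ℕ) (q : (Fin n → Fin 2) → ℝ) : Prop :=
  ∃ a : Fin n → Fin 2 → ℝ, (∀ j s, 0 ≤ a j s) ∧ ∀ x, q x = ∏ j : Fin n, a j (x j)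

/-- Membership in the mixture model `M_{n,k}`: a probability distribution on `{0,1}ⁿ`
expressible as a sum of `k` nonnegative rank-one tensors. -/
def inMnk (n k : ℕ) (p : (Fin n → Fin 2) → ℝ) : Prop :=
  (∀ x, 0 ≤ p x) ∧ (∑ x : Fin n → Fin 2, p x) = 1 ∧
  ∃ f : Fin k → ((Fin n → Fin 2) → ℝ), (∀ i, rankOneN n (f i)) ∧
    ∀ x, p x = ∑ i : Fin k, f i x

/-- A nonnegative rank-one tensor is a nonnegative multiple of a product distribution. -/
theorem rankOneN.exists_smul_prod {n : ℕ} {q : (Fin n → Fin 2) → ℝ} (hq : rankOneN n q) :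
    ∃ c : ℝ, 0 ≤ c ∧ ∃ b : Fin n → Fin 2 → ℝ, (∀ j, b j ∈ stdSimplex ℝ (Fin 2)) ∧
      ∀ x, q x = c * ∏ j, b j (x j) := by
  obtain ⟨a, ha, hqa⟩ := hq
  have key : ∀ j, ∃ b ∈ stdSimplex ℝ (Fin 2), ∀ s, a j s = (∑ t, a j t) * b s := by
    intro j
    by_cases hS : ∑ t, a j t = 0
    · refine ⟨Pi.single 0 1, single_mem_stdSimplex ℝ 0, fun s => ?_⟩
      rw [hS, zero_mul]
      exact (Finset.sum_eq_zero_iff_of_nonneg fun t _ => ha j t).1 hS s (Finset.mem_univ s)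
    · refine ⟨fun s => a j s / ∑ t, a j t, ⟨fun s => ?_, ?_⟩, fun s => ?_⟩
      · exact div_nonneg (ha j s) (Finset.sum_nonneg fun t _ => ha j t)
      · rw [← Finset.sum_div, div_self hS]
      · rw [mul_div_cancel₀ _ hS]
  choose b hb hab using key
  refine ⟨∏ j, ∑ t, a j t, Finset.prod_nonneg fun j _ => Finset.sum_nonneg fun t _ => ha j t,
    b, hb, fun x => ?_⟩
  rw [hqa, ← Finset.prod_mul_distrib]
  exact Finset.prod_congr rfl fun j _ => hab j (x j)

/-- A nonnegative multiple of a product of nonnegative factors is a nonnegative rank-one tensor,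
provided there is at least one factor to absorb the scalar. -/
theorem rankOneN_smul_prod {n : ℕ} (hn : 0 < n) {c : ℝ} (hc : 0 ≤ c) {b : Fin n → Fin 2 → ℝ}
    (hb : ∀ j s, 0 ≤ b j s) : rankOneN n fun x => c * ∏ j, b j (x j) := by
  refine ⟨fun j s => (if j = ⟨0, hn⟩ then c else 1) * b j s, fun j s => ?_, fun x => ?_⟩
  · exact mul_nonneg (by split_ifs <;> simp [hc]) (hb j s)
  · rw [Finset.prod_mul_distrib]
    simp

theorem sum_prod_eq_one_of_mem_stdSimplex {n : ℕ} {b : Fin n → Fin 2 → ℝ}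
    (hb : ∀ j, b j ∈ stdSimplex ℝ (Fin 2)) : ∑ x : Fin n → Fin 2, ∏ j, b j (x j) = 1 := by
  rw [← Fintype.prod_sum]
  exact Finset.prod_eq_one fun j _ => (hb j).2

/-- The mixture with weights `z.1` of the product distributions with marginals `z.2`. -/
def mixture (n k : ℕ) (z : (Fin k → ℝ) × (Fin k → Fin n → Fin 2 → ℝ)) (x : Fin n → Fin 2) : ℝ :=
  ∑ i, z.1 i * ∏ j, z.2 i j (x j)

theorem sum_mixture {n k : ℕ} (c : Fin k → ℝ) {b : Fin k → Fin n → Fin 2 → ℝ}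
    (hb : ∀ i j, b i j ∈ stdSimplex ℝ (Fin 2)) : ∑ x, mixture n k (c, b) x = ∑ i, c i := by
  simp only [mixture]
  rw [Finset.sum_comm]
  refine Finset.sum_congr rfl fun i _ => ?_
  rw [← Finset.mul_sum, sum_prod_eq_one_of_mem_stdSimplex (hb i), mul_one]

theorem setOf_inMnk_eq_image {n k : ℕ} (hn : 0 < n) :
    {p | inMnk n k p} = mixture n k '' (stdSimplex ℝ (Fin k) ×ˢ
      Set.univ.pi fun _ => Set.univ.pi fun _ => stdSimplex ℝ (Fin 2)) := by
  ext p
  constructor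
  · rintro ⟨-, hp, f, hf, hpf⟩
    choose c hc b hb hfb using fun i => (hf i).exists_smul_prod
    have hmix : mixture n k (c, b) = p := by
      ext x
      simp [mixture, hpf, hfb]
    refine ⟨(c, b), ⟨⟨hc, ?_⟩, fun i _ j _ => hb i j⟩, hmix⟩
    rw [← sum_mixture c hb, hmix, hp]
  · rintro ⟨⟨c, b⟩, ⟨hc, hb⟩, rfl⟩
    have hb' : ∀ i j, b i j ∈ stdSimplex ℝ (Fin 2) := fun i j => hb i trivial j trivial
    refine ⟨fun x => ?_, ?_, fun i x => c i * ∏ j, b i j (x j),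
      fun i => rankOneN_smul_prod hn (hc.1 i) fun j => (hb' i j).1, fun x => rfl⟩
    · exact Finset.sum_nonneg fun i _ =>
        mul_nonneg (hc.1 i) (Finset.prod_nonneg fun j _ => (hb' i j).1 _)
    · rw [sum_mixture c hb']
      exact hc.2

theorem stmt7 (n k : ℕ) (hn : 0 < n) (hk : 0 < k) :
    IsClosed {p : (Fin n → Fin 2) → ℝ | inMnk n k p} := by
  rw [setOf_inMnk_eq_image hn]
  have hcont : Continuous (mixture n k) := by
    unfold mixture
    fun_prop
  refine (IsCompact.image ?_ hcont).isClosed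
  exact (isCompact_stdSimplex ℝ (Fin k)).prod <| isCompact_univ_pi fun _ =>
    isCompact_univ_pi fun _ => isCompact_stdSimplex ℝ (Fin 2)
end
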